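/- Let α > 0 and β > 0 be real, b ∈ ℤ, f : ℤ → ℝ, and t ∈ ℤ with t ≤ b − 1. Then (_b∇^{−α}(_b∇^{−β} f))(t) = (_b∇^{−(α+β)} f)(t); in particular nabla right fractional sums commute: (_b∇^{−α}(_b∇^{−β} f))(t) = (_b∇^{−β}(_b∇^{−α} f))(t). -/

import Mathlib

/-- Backward difference operator: `(∇ f)(t) = f t − f (t−1)`. -/
def nablaOp (f : ℤ → ℝ) : ℤ → ℝ := fun t => f t - f (t - 1)

/-- Forward difference operator: `(Δ f)(t) = f (t+1) − f t`. -/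
def deltaOp (f : ℤ → ℝ) : ℤ → ℝ := fun t => f (t + 1) - f t

/-- The operator `−Δ`. -/
def negDeltaOp (f : ℤ → ℝ) : ℤ → ℝ := fun t => -(f (t + 1) - f t)

/-- Nabla left fractional sum of order `α` starting at `a`:
`(∇_a^{-α} f)(t) = (1/Γ(α)) Σ_{s=a+1}^{t} [Γ(t−s+α)/Γ(t−s+1)] f(s)`. -/
noncomputable def nablaLeftSum (a : ℤ) (α : ℝ) (f : ℤ → ℝ) : ℤ → ℝ := fun t =>
  (1 / Real.Gamma α) * ∑ s ∈ Finset.Icc (a + 1) t,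
    (Real.Gamma ((t : ℝ) - (s : ℝ) + α) / Real.Gamma ((t : ℝ) - (s : ℝ) + 1)) * f s

/-- Nabla right fractional sum of order `α` ending at `b`:
`(_b∇^{-α} f)(t) = (1/Γ(α)) Σ_{s=t}^{b−1} [Γ(s−t+α)/Γ(s−t+1)] f(s)`. -/
noncomputable def nablaRightSum (b : ℤ) (α : ℝ) (f : ℤ → ℝ) : ℤ → ℝ := fun t =>
  (1 / Real.Gamma α) * ∑ s ∈ Finset.Icc t (b - 1),
    (Real.Gamma ((s : ℝ) - (t : ℝ) + α) / Real.Gamma ((s : ℝ) - (t : ℝ) + 1)) * f s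

/-- The nabla fractional kernel `Γ(n + α) / (Γ(n + 1) Γ(α))`. -/
noncomputable def nablaKernel (α : ℝ) (n : ℕ) : ℝ :=
  1 / Real.Gamma α * (Real.Gamma (n + α) / Real.Gamma (n + 1))

theorem nablaKernel_zero {α : ℝ} (hα : 0 < α) : nablaKernel α 0 = 1 := by
  have := (Real.Gamma_pos_of_pos hα).ne'
  simp [nablaKernel, this]

theorem nablaKernel_succ {α : ℝ} (hα : 0 < α) (n : ℕ) :
    ((n : ℝ) + 1) * nablaKernel α (n + 1) = (n + α) * nablaKernel α n := by
  have hn : ((n : ℝ) + 1) ≠ 0 := by positivity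
  have hΓ : Real.Gamma ((n : ℝ) + 1) ≠ 0 := (Real.Gamma_pos_of_pos (by positivity)).ne'
  have hΓα := (Real.Gamma_pos_of_pos hα).ne'
  have h : ((n + 1 : ℕ) : ℝ) + α = (n + α) + 1 := by push_cast; ring
  rw [nablaKernel, nablaKernel, h, Real.Gamma_add_one (by positivity), Nat.cast_succ,
    Real.Gamma_add_one hn]
  field_simp

/-- The Chu–Vandermonde identity for nabla kernels. -/
theorem sum_antidiagonal_nablaKernel {α β : ℝ} (hα : 0 < α) (hβ : 0 < β) (n : ℕ) :
    ∑ p ∈ Finset.HasAntidiagonal.antidiagonal n, nablaKernel α p.1 * nablaKernel β p.2 =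
      nablaKernel (α + β) n := by
  induction n with
  | zero => simp [nablaKernel_zero, hα, hβ, add_pos hα hβ]
  | succ n ih =>
    have hn : ((n : ℝ) + 1) ≠ 0 := by positivity
    apply mul_left_cancel₀ hn
    rw [nablaKernel_succ (add_pos hα hβ), ← ih, Finset.mul_sum, Finset.mul_sum]
    have hsplit : ∀ p ∈ Finset.HasAntidiagonal.antidiagonal (n + 1),
        ((n : ℝ) + 1) * (nablaKernel α p.1 * nablaKernel β p.2) =
          (p.1 * nablaKernel α p.1) * nablaKernel β p.2 +
            nablaKernel α p.1 * (p.2 * nablaKernel β p.2) := by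
      intro p hp
      have h : (p.1 : ℝ) + p.2 = n + 1 := by exact_mod_cast Finset.HasAntidiagonal.mem_antidiagonal.1 hp
      rw [← h]
      ring
    rw [Finset.sum_congr rfl hsplit, Finset.sum_add_distrib, Finset.Nat.sum_antidiagonal_succ,
      Finset.Nat.sum_antidiagonal_succ']
    simp only [Nat.cast_zero, zero_mul, mul_zero, zero_add, Nat.cast_succ,
      nablaKernel_succ hα, nablaKernel_succ hβ]
    rw [← Finset.sum_add_distrib]
    refine Finset.sum_congr rfl fun p hp => ?_
    have h : (p.1 : ℝ) + p.2 = n := by exact_mod_cast Finset.HasAntidiagonal.mem_antidiagonal.1 hp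
    rw [← h]
    ring

theorem sum_Icc_nablaKernel {α β : ℝ} (hα : 0 < α) (hβ : 0 < β) {t r : ℤ} (htr : t ≤ r) :
    ∑ s ∈ Finset.Icc t r, nablaKernel α (s - t).toNat * nablaKernel β (r - s).toNat =
      nablaKernel (α + β) (r - t).toNat := by
  rw [← sum_antidiagonal_nablaKernel hα hβ]
  refine Finset.sum_nbij' (fun s => ((s - t).toNat, (r - s).toNat)) (fun p => t + p.1)
    ?_ ?_ ?_ ?_ ?_
  · intro s hs
    simp only [Finset.mem_Icc, Finset.HasAntidiagonal.mem_antidiagonal] at *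
    omega
  · intro p hp
    simp only [Finset.mem_Icc, Finset.HasAntidiagonal.mem_antidiagonal] at *
    omega
  · intro s hs
    simp only [Finset.mem_Icc] at *
    omega
  · rintro ⟨i, j⟩ hp
    simp only [Finset.HasAntidiagonal.mem_antidiagonal, Prod.mk.injEq] at *
    omega
  · intro s _
    rfl

theorem nablaRightSum_eq_sum_nablaKernel (b : ℤ) (α : ℝ) (f : ℤ → ℝ) (t : ℤ) :
    nablaRightSum b α f t = ∑ s ∈ Finset.Icc t (b - 1), nablaKernel α (s - t).toNat * f s := by
  rw [nablaRightSum, Finset.mul_sum]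
  refine Finset.sum_congr rfl fun s hs => ?_
  have h : (((s - t).toNat : ℕ) : ℝ) = (s : ℝ) - t := by
    have : ((s - t).toNat : ℤ) = s - t :=
      Int.toNat_of_nonneg (sub_nonneg.2 (Finset.mem_Icc.1 hs).1)
    exact_mod_cast this
  rw [nablaKernel, h, mul_assoc]

theorem nablaRightSum_nablaRightSum {α β : ℝ} (hα : 0 < α) (hβ : 0 < β) (b : ℤ) (f : ℤ → ℝ)
    (t : ℤ) : nablaRightSum b α (nablaRightSum b β f) t = nablaRightSum b (α + β) f t := by
  simp only [nablaRightSum_eq_sum_nablaKernel, Finset.mul_sum]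
  rw [Finset.sum_comm' (t' := Finset.Icc t (b - 1)) (s' := fun r => Finset.Icc t r)
    (by intro s r; simp only [Finset.mem_Icc]; omega)]
  refine Finset.sum_congr rfl fun r hr => ?_
  rw [← sum_Icc_nablaKernel hα hβ (Finset.mem_Icc.1 hr).1, Finset.sum_mul]
  exact Finset.sum_congr rfl fun s _ => (mul_assoc _ _ _).symm

theorem stmt5 (α β : ℝ) (hα : 0 < α) (hβ : 0 < β) (b : ℤ) (f : ℤ → ℝ) (t : ℤ)
    (ht : t ≤ b - 1) :
    nablaRightSum b α (nablaRightSum b β f) t = nablaRightSum b (α + β) f t ∧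
      nablaRightSum b α (nablaRightSum b β f) t = nablaRightSum b β (nablaRightSum b α f) t := by
  refine ⟨nablaRightSum_nablaRightSum hα hβ b f t, ?_⟩
  rw [nablaRightSum_nablaRightSum hα hβ, nablaRightSum_nablaRightSum hβ hα, add_comm]
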